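/- For every integer N and all y, z ∈ K, the bilinear difference equation holds: q^{2N}·y·φ_N(y/q,z)·φ_N(y,z) + q^N·(1 + z)·φ_N(y,qz)·φ_N(y/q,z/q) = ((1 − q^{2N+1})/(1 − q))·φ_{N+1}(y,z)·φ_{N−1}(y/q,z). -/

import Mathlib

open Matrix Finset

/-- The Jacobi--Trudi type determinant: `det (p (n - 2i + j) y z)_{0 ≤ i,j ≤ n-1}`. -/
noncomputable def phiAux {K : Type*} [Field K] (p : ℤ → K → K → K) (n : ℕ) (y z : K) : K :=
  Matrix.det (Matrix.of fun i j : Fin n => p ((n : ℤ) - 2 * ((i : ℕ) : ℤ) + ((j : ℕ) : ℤ)) y z)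

/-- The polynomials `φ_N(y,z)`: for `N ≥ 0` the Jacobi--Trudi determinant (with `φ_0 = 1`
as the empty determinant), and for `N < 0` we set `φ_N = (-1)^(N(N+1)/2) φ_(-N-1)`. -/
noncomputable def phi {K : Type*} [Field K] (p : ℤ → K → K → K) (N : ℤ) (y z : K) : K :=
  if 0 ≤ N then phiAux p N.toNat y z
  else (-1 : K) ^ (N * (N + 1) / 2) * phiAux p (-N - 1).toNat y z

/-- The Jacobi-Trudi determinant of size `m` whose rows start at `s, s - 2, s - 4, …`. -/
noncomputable def stairDet {K : Type*} [Field K] (f : ℤ → K) (s : ℤ) (m : ℕ) : K :=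
  Matrix.det (Matrix.of fun j i : Fin m => f (s - 2 * ((i : ℕ) : ℤ) + ((j : ℕ) : ℤ)))

/-- Coefficients of `(1 - c t) F(t)`, where `F` has coefficients `f`. -/
def twist {K : Type*} [Field K] (c : K) (f : ℤ → K) : ℤ → K := fun k => f k - c * f (k - 1)

theorem phiAux_eq_stairDet {K : Type*} [Field K] (p : ℤ → K → K → K) (n : ℕ) (y z : K) :
    phiAux p n y z = stairDet (fun k => p k y z) n n := by
  rw [phiAux, ← Matrix.det_transpose]
  rfl

theorem twist_comm {K : Type*} [Field K] (a b : K) (f : ℤ → K) :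
    twist a (twist b f) = twist b (twist a f) := by
  funext k
  simp only [twist]
  ring

/-- Three-term Plücker relation for determinants sharing all rows except `i` and `j`. -/
theorem det_plucker {K ι : Type*} [Field K] [Fintype ι] [DecidableEq ι] (M : Matrix ι ι K)
    {i j : ι} (hij : i ≠ j) (b c x d : ι → K) :
    ((M.updateRow i b).updateRow j c).det * ((M.updateRow i x).updateRow j d).det
      = ((M.updateRow i x).updateRow j c).det * ((M.updateRow i b).updateRow j d).det
        + ((M.updateRow i b).updateRow j x).det * ((M.updateRow i c).updateRow j d).det := by
  set B := (M.updateRow i b).updateRow j c with hB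
  have hBi : B i = b := by
    rw [hB, Matrix.updateRow_ne hij, Matrix.updateRow_self]
  have hBj : B j = c := by rw [hB, Matrix.updateRow_self]
  have key : B.det • x = ∑ k, (B.updateRow k x).det • B k := by
    have h := Matrix.mulVec_cramer Bᵀ x
    rw [Matrix.det_transpose] at h
    rw [← h]
    funext l
    simp only [Matrix.mulVec, dotProduct, Matrix.transpose_apply, Matrix.cramer_transpose_apply,
      Finset.sum_apply, Pi.smul_apply, smul_eq_mul]
    exact Finset.sum_congr rfl fun k _ => mul_comm _ _
  have hupd : ∀ w : ι → K, (M.updateRow i w).updateRow j d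
      = (B.updateRow j d).updateRow i w := by
    intro w
    ext k l
    simp only [hB, Matrix.updateRow_apply]
    split_ifs <;> simp_all
  let L : (ι → K) →ₗ[K] K :=
    { toFun := fun w => ((M.updateRow i w).updateRow j d).det
      map_add' := fun u w => by simp only [hupd, Matrix.det_updateRow_add]
      map_smul' := fun r w => by simp only [hupd, Matrix.det_updateRow_smul]; rfl }
  have hL : ∀ w, ((M.updateRow i w).updateRow j d).det = L w := fun _ => rfl
  have hzero : ∀ k, k ≠ i → k ≠ j → L (B k) = 0 := by
    intro k hki hkj
    rw [← hL, hupd]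
    refine Matrix.det_zero_of_row_eq hki ?_
    rw [Matrix.updateRow_self, Matrix.updateRow_ne hki, Matrix.updateRow_ne hkj]
  have h2 := congrArg L key
  rw [map_smul, map_sum, ← Finset.add_sum_erase _ _ (Finset.mem_univ i),
    ← Finset.add_sum_erase _ _ (Finset.mem_erase.2 ⟨hij.symm, Finset.mem_univ j⟩),
    Finset.sum_eq_zero] at h2
  · have e1 : B.updateRow i x = (M.updateRow i x).updateRow j c := by
      rw [hB, Matrix.updateRow_comm _ hij.symm, Matrix.updateRow_idem,
        Matrix.updateRow_comm _ hij]
    have e2 : B.updateRow j x = (M.updateRow i b).updateRow j x := by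
      rw [hB, Matrix.updateRow_idem]
    simp only [map_smul, smul_eq_mul, hBi, hBj, add_zero, e1, e2] at h2
    simpa only [hL] using h2
  · intro k hk
    rw [Finset.mem_erase, Finset.mem_erase] at hk
    rw [map_smul, hzero k hk.2.1 hk.1, smul_zero]

/-- A unitriangular row operation turning all rows but the first into twisted rows. -/
theorem det_rows_twist {K : Type*} [Field K] (c : K) (f : ℤ → K) (s : ℤ) (m : ℕ) :
    Matrix.det (Matrix.of fun j i : Fin (m + 1) =>
      if j = 0 then f (s - 2 * ((i : ℕ) : ℤ)) else
        twist c f (s - 2 * ((i : ℕ) : ℤ) + ((j : ℕ) : ℤ))) = stairDet f s (m + 1) := by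
  symm
  refine Matrix.det_eq_of_forall_row_eq_smul_add_pred (fun _ => c) ?_ ?_
  · intro i
    simp
  · intro k i
    simp only [Matrix.of_apply, Fin.succ_ne_zero, if_false, twist, Fin.val_succ,
      Fin.val_castSucc]
    push_cast
    rw [show s - 2 * ((i : ℕ) : ℤ) + (((k : ℕ) : ℤ) + 1) - 1
      = s - 2 * ((i : ℕ) : ℤ) + ((k : ℕ) : ℤ) by ring]
    ring

theorem stairDet_succ {K : Type*} [Field K] {f : ℤ → K} (hneg : ∀ k < 0, f k = 0)
    (h0 : f 0 = 1) (n : ℕ) : stairDet f n (n + 1) = stairDet f n n := by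
  rw [stairDet, Matrix.det_succ_column _ (Fin.last n), Finset.sum_eq_single (Fin.last n)]
  · rw [stairDet]
    have : f ((n : ℤ) - 2 * n + n) = 1 := by rw [← h0]; congr 1; ring
    simp only [Matrix.of_apply, Fin.val_last, this, Even.neg_one_pow ⟨n, rfl⟩, one_mul]
    congr 1
    ext j i
    simp [Fin.succAbove_last]
  · intro j _ hj
    have hlt : (j : ℕ) < n := Fin.val_lt_last hj
    rw [Matrix.of_apply, hneg _ (by rw [Fin.val_last]; lia)]
    ring
  · simp

theorem twist_neg {K : Type*} [Field K] {f : ℤ → K} (hneg : ∀ k < 0, f k = 0) (c : K) :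
    ∀ k < 0, twist c f k = 0 := by
  intro k hk
  rw [twist, hneg k hk, hneg (k - 1) (by lia)]
  ring

theorem twist_zero_eq_one {K : Type*} [Field K] {f : ℤ → K} (hneg : ∀ k < 0, f k = 0)
    (h0 : f 0 = 1) (c : K) : twist c f 0 = 1 := by
  rw [twist, h0, hneg (0 - 1) (by lia)]
  ring

/-- The rows of `stairDet` shifted by one, with the first row twisted by `a` and the others by
both `a` and `b`. -/
theorem det_rows_twist_twist {K : Type*} [Field K] (a b : K) (f : ℤ → K) (s : ℤ) (m : ℕ) :
    Matrix.det (Matrix.of fun j i : Fin (m + 1) =>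
      if j = 0 then f (s - 2 * ((i : ℕ) : ℤ)) else
      if (j : ℕ) = 1 then twist a f (s - 2 * ((i : ℕ) : ℤ) + 1) else
        twist b (twist a f) (s - 2 * ((i : ℕ) : ℤ) + ((j : ℕ) : ℤ))) = stairDet f s (m + 1) := by
  rw [← det_rows_twist a]
  symm
  refine Matrix.det_eq_of_forall_row_eq_smul_add_pred
    (fun k => if (k : ℕ) = 0 then 0 else b) ?_ ?_
  · intro i
    simp
  · intro k i
    by_cases hk : (k : ℕ) = 0
    · simp [hk, Fin.succ_ne_zero]
    · have hk' : k.castSucc ≠ 0 := by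
        intro h
        apply hk
        simpa using congrArg Fin.val h
      simp only [Matrix.of_apply, Fin.succ_ne_zero, if_false, Fin.val_succ,
        Fin.val_castSucc, hk, hk', Nat.add_eq_right]
      rw [twist.eq_def b]
      push_cast
      rw [show s - 2 * ((i : ℕ) : ℤ) + (((k : ℕ) : ℤ) + 1) - 1
        = s - 2 * ((i : ℕ) : ℤ) + ((k : ℕ) : ℤ) by ring]
      ring

theorem stairDet_bilinear_succ {K : Type*} [Field K] {f : ℤ → K} (hneg : ∀ k < 0, f k = 0)
    (h0 : f 0 = 1) (a b : K) (n : ℕ) :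
    stairDet (twist a f) (n + 2 : ℕ) (n + 2) * stairDet (twist b f) n n
      - stairDet (twist a f) n n * stairDet (twist b f) (n + 2 : ℕ) (n + 2)
      = (b - a) * stairDet (twist a (twist b f)) (n + 1 : ℕ) (n + 1)
        * stairDet f (n + 1 : ℕ) (n + 1) := by
  let h := twist a (twist b f)
  let row : ℤ → (ℤ → K) → Fin (n + 2) → K :=
    fun c g i => g ((n + 2 : ℤ) - 2 * ((i : ℕ) : ℤ) + c)
  let M : Matrix (Fin (n + 2)) (Fin (n + 2)) K := Matrix.of fun j => row ((j : ℕ) : ℤ) h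
  let e : Fin (n + 2) → K := Pi.single 0 1
  let D : (Fin (n + 2) → K) → (Fin (n + 2) → K) → K :=
    fun x y => ((M.updateRow 0 x).updateRow (Fin.last (n + 1)) y).det
  have hl : (0 : Fin (n + 2)) ≠ Fin.last (n + 1) := (Fin.last_pos).ne
  have hpl : D (row 0 (twist a f)) e * D (row 0 (twist b f)) (M (Fin.last (n + 1)))
      = D (row 0 (twist b f)) e * D (row 0 (twist a f)) (M (Fin.last (n + 1)))
        + D (row 0 (twist a f)) (row 0 (twist b f)) * D e (M (Fin.last (n + 1))) :=
    det_plucker M hl _ _ _ _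
  have hlast : ∀ x, (M.updateRow 0 x).updateRow (Fin.last (n + 1)) (M (Fin.last (n + 1)))
      = M.updateRow 0 x := by
    intro x
    rw [Matrix.updateRow_comm _ hl, Matrix.updateRow_eq_self]
  have h1 : ∀ c d : K, h = twist d (twist c f) →
      D (row 0 (twist c f)) (M (Fin.last (n + 1))) = stairDet (twist c f) (n + 2 : ℕ) (n + 2) := by
    intro c d hcd
    simp only [D]
    rw [hlast, ← det_rows_twist d]
    congr 1
    ext j i
    by_cases hj : j = 0
    · simp [hj, row]
    · simp [hj, M, row, hcd]
  have h2 : ∀ c d : K, h = twist d (twist c f) →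
      D (row 0 (twist c f)) e = (-1) ^ (n + 1) * stairDet (twist c f) n n := by
    intro c d hcd
    simp only [D]
    rw [Matrix.det_succ_row _ (Fin.last (n + 1)), Finset.sum_eq_single 0]
    · rw [← stairDet_succ (twist_neg hneg c) (twist_zero_eq_one hneg h0 c), ← det_rows_twist d]
      simp only [Matrix.updateRow_self, e, Pi.single_eq_same, Fin.val_last, Fin.val_zero, add_zero,
        mul_one]
      congr 2
      ext j i
      by_cases hj : j = 0
      · subst hj
        rw [Matrix.submatrix_apply, Fin.succAbove_last, Fin.castSucc_zero, Matrix.updateRow_ne hl, Matrix.updateRow_self]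
        simp [row]
        congr 1; ring
      · have hj' : j.castSucc ≠ 0 := by simpa using hj
        simp [hj, hj', Matrix.updateRow_apply, M, row, hcd, Fin.succAbove_last]
        congr 1; ring
    · intro k _ hk
      simp [e, hk]
    · simp
  have h3 : D e (M (Fin.last (n + 1))) = stairDet h (n + 1 : ℕ) (n + 1) := by
    simp only [D]
    rw [hlast, Matrix.det_succ_row_zero, Finset.sum_eq_single 0]
    · simp only [Matrix.updateRow_self, e, Pi.single_eq_same, Fin.val_zero, pow_zero, mul_one,
        one_mul, stairDet]
      congr 1
      ext j i
      simp [M, row]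
      congr 1; ring
    · intro k _ hk
      simp [e, hk]
    · simp
  have h4 : D (row 0 (twist a f)) (row 0 (twist b f))
      = (-1) ^ (n + 1) * ((a - b) * stairDet f (n + 1 : ℕ) (n + 1)) := by
    let B : Matrix (Fin (n + 2)) (Fin (n + 2)) K := Matrix.of fun j i =>
      if j = 0 then row (-1) f i else
      if (j : ℕ) = 1 then row 0 (twist a f) i else row (((j : ℕ) : ℤ) - 1) h i
    have hB : B.det = stairDet f (n + 1 : ℕ) (n + 1) := by
      rw [← stairDet_succ hneg h0, ← det_rows_twist_twist a b]
      congr 1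
      ext j i
      simp only [B, Matrix.of_apply, row, h, twist_comm a b]
      push_cast
      split_ifs <;> congr 1 <;> ring
    have hrot : (M.updateRow 0 (row 0 (twist a f))).updateRow (Fin.last (n + 1))
        (row 0 (twist b f))
        = (B.updateRow 0 (row 0 (twist b f))).submatrix (finRotate (n + 2)) id := by
      ext j i
      induction j using Fin.lastCases with
      | last => simp
      | cast j =>
        have hjl : j.castSucc ≠ Fin.last (n + 1) := (Fin.castSucc_lt_last j).ne
        have hr : finRotate (n + 2) j.castSucc = j.succ := by
          rw [finRotate_apply]; simp
        rw [Matrix.submatrix_apply, hr, Matrix.updateRow_ne hjl,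
          Matrix.updateRow_ne (Fin.succ_ne_zero j)]
        by_cases hj : j = 0
        · subst hj
          simp [B]
        · have hj' : j.castSucc ≠ 0 := by simpa using hj
          have hj2 : (j : ℕ) ≠ 0 := fun h => hj (Fin.ext h)
          rw [Matrix.updateRow_ne hj']
          simp [B, M, hj2, Fin.succ_ne_zero]
    have hsplit : row 0 (twist b f) = (a - b) • row (-1) f + row 0 (twist a f) := by
      funext i
      simp only [row, twist, Pi.add_apply, Pi.smul_apply, smul_eq_mul, add_zero,
        ← sub_eq_add_neg]
      ring
    have hzero : (B.updateRow 0 (row 0 (twist a f))).det = 0 := by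
      refine Matrix.det_zero_of_row_eq (i := 0) (j := 1) (by simp) ?_
      rw [Matrix.updateRow_self, Matrix.updateRow_ne (by simp)]
      funext i
      simp [B]
    have hself : B.updateRow 0 (row (-1) f) = B := by
      conv_rhs => rw [← Matrix.updateRow_eq_self B 0]
      rfl
    simp only [D]
    rw [hrot, Matrix.det_permute, hsplit, Matrix.det_updateRow_add, Matrix.det_updateRow_smul,
      hzero, hself, hB, sign_finRotate]
    simp
  rw [h1 a b (twist_comm a b f), h1 b a rfl, h2 a b (twist_comm a b f), h2 b a rfl, h3, h4] at hpl
  have hs : ((-1 : K) ^ (n + 1)) ^ 2 = 1 := by rw [← pow_mul, mul_comm, pow_mul]; simp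
  have : h = twist a (twist b f) := rfl
  rw [← this]
  linear_combination (-(-1 : K) ^ (n + 1)) * hpl
    - (stairDet (twist a f) (n + 2 : ℕ) (n + 2) * stairDet (twist b f) n n
      - stairDet (twist a f) n n * stairDet (twist b f) (n + 2 : ℕ) (n + 2)
      - (b - a) * stairDet h (n + 1 : ℕ) (n + 1)
        * stairDet f (n + 1 : ℕ) (n + 1)) * hs

/-- Bilinear relation between staircase determinants of `F`, `(1 - a t) F`, `(1 - b t) F` and
`(1 - a t) (1 - b t) F`. -/
theorem stairDet_bilinear {K : Type*} [Field K] {f : ℤ → K} (hneg : ∀ k < 0, f k = 0)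
    (h0 : f 0 = 1) (a b : K) (n : ℕ) :
    stairDet (twist a f) (n + 1 : ℕ) (n + 1) * stairDet (twist b f) (n - 1 : ℕ) (n - 1)
      - stairDet (twist a f) (n - 1 : ℕ) (n - 1) * stairDet (twist b f) (n + 1 : ℕ) (n + 1)
      = (b - a) * stairDet (twist a (twist b f)) n n * stairDet f n n := by
  cases n with
  | zero => simp [stairDet, twist, h0]
  | succ n => exact stairDet_bilinear_succ hneg h0 a b n

theorem stairDet_scale {K : Type*} [Field K] {q : K} (hq : q ≠ 0) (f : ℤ → K) (n : ℕ) :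
    stairDet (fun k => q ^ k * f k) n n = q ^ (n * (n + 1) / 2) * stairDet f n n := by
  have h1 : stairDet (fun k => q ^ k * f k) n n = Matrix.det (Matrix.of fun j i : Fin n =>
      q ^ ((n : ℤ) - 2 * ((i : ℕ) : ℤ)) * (Matrix.of fun j i : Fin n =>
      q ^ (j : ℕ) * (Matrix.of fun j i : Fin n =>
        f ((n : ℤ) - 2 * ((i : ℕ) : ℤ) + ((j : ℕ) : ℤ))) j i) j i) := by
    rw [stairDet]
    congr 1
    ext j i
    simp only [Matrix.of_apply]
    rw [zpow_add₀ hq, zpow_natCast]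
    ring
  have hprod : ∏ i : Fin n, (q ^ ((n : ℤ) - 2 * ((i : ℕ) : ℤ)) * q ^ (i : ℕ))
      = q ^ (n * (n + 1) / 2) := by
    have : ∀ i : Fin n, q ^ ((n : ℤ) - 2 * ((i : ℕ) : ℤ)) * q ^ (i : ℕ)
        = q ^ (n - 1 - (i : ℕ) + 1) := by
      intro i
      have := i.isLt
      rw [← zpow_natCast, ← zpow_natCast, ← zpow_add₀ hq]
      congr 1
      lia
    rw [Finset.prod_congr rfl fun i _ => this i,
      Fin.prod_univ_eq_prod_range (fun i => q ^ (n - 1 - i + 1)) n,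
      Finset.prod_range_reflect (fun i => q ^ (i + 1)) n, Finset.prod_pow_eq_pow_sum]
    congr 1
    have h := Finset.sum_range_succ' (fun i => i) n
    rw [add_zero] at h
    rw [← h, Finset.sum_range_id, mul_comm]
    rfl
  rw [h1, Matrix.det_mul_row, Matrix.det_mul_column, ← mul_assoc, ← Finset.prod_mul_distrib,
    hprod, stairDet]

theorem phi_natCast {K : Type*} [Field K] (p : ℤ → K → K → K) (n : ℕ) (y z : K) :
    phi p n y z = phiAux p n y z := by
  simp [phi]

theorem phi_natCast_sub_one {K : Type*} [Field K] (p : ℤ → K → K → K) (n : ℕ) (y z : K) :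
    phi p (n - 1) y z = phiAux p (n - 1) y z := by
  cases n with
  | zero => simp [phi]
  | succ n => simp [phi]

theorem phi_neg_natCast {K : Type*} [Field K] (p : ℤ → K → K → K) (n : ℕ) (y z : K) :
    phi p (-n) y z = (-1) ^ (n * (n - 1) / 2) * phiAux p (n - 1) y z := by
  cases n with
  | zero => simp [phi]
  | succ n =>
    have h : ¬ (0 : ℤ) ≤ -((n + 1 : ℕ) : ℤ) := by lia
    rw [phi, if_neg h, show (-(-((n + 1 : ℕ) : ℤ)) - 1).toNat = n by lia,
      show -((n + 1 : ℕ) : ℤ) * (-((n + 1 : ℕ) : ℤ) + 1) / 2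
        = (((n + 1) * (n + 1 - 1) / 2 : ℕ) : ℤ) by push_cast; congr 1; simp; ring, zpow_natCast]
    simp

theorem bilinear_bl7
    {K : Type*} [Field K] (q : K) (hq0 : q ≠ 0)
    (hq1 : ∀ k : ℕ, 1 ≤ k → q ^ k ≠ 1)
    (p : ℤ → K → K → K)
    (hp_neg : ∀ k : ℤ, k < 0 → ∀ y z : K, p k y z = 0)
    (hp_zero : ∀ y z : K, p 0 y z = 1)
    (hC1 : ∀ k : ℕ, 1 ≤ k → ∀ y z : K,
      (∑ i ∈ Finset.range k, q ^ i) * p (k : ℤ) y z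
        = (y + z + q ^ (k - 1)) * p ((k : ℤ) - 1) y z
          - (1 - q) * y * z * p ((k : ℤ) - 2) y z)
    (hC2 : ∀ (k : ℤ) (y z : K), p k y (q * z) - p k y z = (q - 1) * z * p (k - 1) y z)
    (hC3 : ∀ (k : ℤ) (y z : K), p k (q * y) z - p k y z = (q - 1) * y * p (k - 1) y z)
    (N : ℤ) (y z : K) :
    q ^ (2 * N) * y * phi p N (y / q) z * phi p N y z
      + q ^ N * (1 + z) * phi p N y (q * z) * phi p N (y / q) (z / q)
    = (1 - q ^ (2 * N + 1)) / (1 - q) * phi p (N + 1) y z * phi p (N - 1) (y / q) z := by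
  have hq : 1 - q ≠ 0 := by
    have := hq1 1 le_rfl
    rw [pow_one] at this
    exact sub_ne_zero.2 this.symm
  have hscale : ∀ (k : ℤ) (y z : K), p k (q * y) (q * z)
      = q ^ k * twist (-(1 - q) / q) (fun k => p k y z) k := by
    intro k y z
    rcases lt_or_ge k 0 with hk | hk
    · rw [twist, hp_neg k hk, hp_neg k hk, hp_neg (k - 1) (by lia)]
      ring
    · obtain ⟨n, rfl⟩ := Int.eq_ofNat_of_zero_le hk
      cases n with
      | zero => simp [twist, hp_zero, hp_neg]
      | succ n =>
        have e1 := hC1 (n + 1) (by lia) y z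
        have e2 := hC2 (n + 1 : ℕ) (q * y) z
        have e3 := hC3 (n + 1 : ℕ) y z
        have e4 := hC3 ((n + 1 : ℕ) - 1) y z
        have e5 := geom_sum_mul q (n + 1)
        rw [show ((n + 1 : ℕ) : ℤ) - 1 - 1 = ((n + 1 : ℕ) : ℤ) - 2 by ring] at e4
        rw [twist, zpow_natCast]
        simp only [Nat.add_sub_cancel] at e1
        have e6 : -(1 - q) / q * q ^ (n + 1) = -(1 - q) * q ^ n := by
          rw [pow_succ]
          field_simp
        linear_combination e2 + e3 + (q - 1) * z * e4 + (1 - q) * e1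
          + p (n + 1 : ℕ) y z * e5 + p ((n + 1 : ℕ) - 1) y z * e6
  have hy : q * (y / q) = y := mul_div_cancel₀ y hq0
  have hz : q * (z / q) = z := mul_div_cancel₀ z hq0
  have hG : (fun k => p k (y / q) z)
      = twist ((1 - q) * z / q) (fun k => p k (y / q) (z / q)) := by
    funext k
    have := hC2 k (y / q) (z / q)
    rw [hz] at this
    rw [twist]
    linear_combination this
  have hPu : (fun k => p k y z) = twist ((1 - q) * y / q) (fun k => p k (y / q) z) := by
    funext k
    have := hC3 k (y / q) z
    rw [hy] at this
    rw [twist]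
    linear_combination this
  have hP : (fun k => p k y z)
      = fun k => q ^ k * twist (-(1 - q) / q) (fun k => p k (y / q) (z / q)) k := by
    funext k
    rw [← hscale, hy, hz]
  have hQ : (fun k => p k y (q * z))
      = fun k => q ^ k * twist (-(1 - q) / q)
        (twist ((1 - q) * z / q) (fun k => p k (y / q) (z / q))) k := by
    funext k
    rw [← hG, ← hscale, hy]
  have tri : ∀ n : ℕ, q ^ ((n + 1) * (n + 1 + 1) / 2) = q ^ (n * (n + 1) / 2) * q ^ (n + 1) := by
    intro n
    rw [← pow_add]
    congr 1
    rw [show (n + 1) * (n + 1 + 1) = n * (n + 1) + (n + 1) * 2 by ring,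
      Nat.add_mul_div_right _ _ (by norm_num)]
  have tri' : ∀ n : ℕ, q ^ (n * (n + 1) / 2) = q ^ ((n - 1) * (n - 1 + 1) / 2) * q ^ n := by
    intro n
    cases n with
    | zero => simp
    | succ n => exact tri n
  have hC : ∀ n : ℕ, phiAux p (n + 1) y z * phiAux p (n - 1) (y / q) z
      - q ^ (2 * n + 1) * (phiAux p (n - 1) y z * phiAux p (n + 1) (y / q) z)
      = (1 - q) * (1 + z) * q ^ n * phiAux p n y (q * z) * phiAux p n (y / q) (z / q) := by
    intro n
    have h := stairDet_bilinear (f := fun k => p k (y / q) (z / q))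
      (fun k hk => hp_neg k hk _ _) (hp_zero _ _) (-(1 - q) / q) ((1 - q) * z / q) n
    simp only [phiAux_eq_stairDet, hG, hP, hQ]
    rw [stairDet_scale hq0, stairDet_scale hq0, stairDet_scale hq0, tri, tri' n]
    have e : ((1 - q) * z / q - -(1 - q) / q) * q = (1 - q) * (1 + z) := by
      field_simp
      ring
    rw [← e]
    linear_combination q ^ ((n - 1) * (n - 1 + 1) / 2) * q ^ (2 * n + 1) * h
  have hD : ∀ n : ℕ, q * (phiAux p (n + 1) y z * phiAux p (n - 1) (y / q) z
      - phiAux p (n - 1) y z * phiAux p (n + 1) (y / q) z)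
      = -((1 - q) * y * phiAux p n y z * phiAux p n (y / q) z) := by
    intro n
    have h := stairDet_bilinear (f := fun k => p k (y / q) z)
      (fun k hk => hp_neg k hk _ _) (hp_zero _ _) ((1 - q) * y / q) 0 n
    have h0 : twist 0 (fun k => p k (y / q) z) = fun k => p k (y / q) z := by
      funext k
      simp [twist]
    rw [h0, ← hPu] at h
    simp only [phiAux_eq_stairDet]
    rw [h]
    field_simp
    ring
  rcases lt_or_ge N 0 with hN | hN
  · obtain ⟨n, rfl⟩ : ∃ n : ℕ, N = -((n + 1 : ℕ) : ℤ) := ⟨(-N - 1).toNat, by lia⟩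
    have e1 : -((n + 1 : ℕ) : ℤ) + 1 = -(n : ℤ) := by push_cast; ring
    have e2 : -((n + 1 : ℕ) : ℤ) - 1 = -((n + 2 : ℕ) : ℤ) := by push_cast; ring
    rw [e1, e2]
    simp only [phi_neg_natCast, Nat.add_sub_cancel, show n + 2 - 1 = n + 1 by lia]
    have s1 : ((-1 : K) ^ ((n + 1) * n / 2)) * (-1 : K) ^ ((n + 1) * n / 2) = 1 := by
      rw [← mul_pow]; simp
    have s2 : ((-1 : K) ^ (n * (n - 1) / 2)) * (-1 : K) ^ ((n + 2) * (n + 1) / 2) = -1 := by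
      rw [← pow_add]
      have hodd : Odd (n * (n - 1) / 2 + (n + 2) * (n + 1) / 2) := by
        have a1 : (n + 2) * (n + 1) = n * (n - 1) + (2 * n + 1) * 2 := by
          cases n with
          | zero => rfl
          | succ n => simp only [Nat.add_sub_cancel]; ring
        rw [a1, Nat.add_mul_div_right _ _ (by norm_num)]
        exact ⟨n * (n - 1) / 2 + n, by ring⟩
      exact hodd.neg_one_pow
    have z1 : q ^ (2 * -((n + 1 : ℕ) : ℤ)) = (q ^ (2 * n + 2))⁻¹ := by
      rw [← zpow_natCast, ← _root_.zpow_neg]; congr 1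
    have z2 : q ^ (-((n + 1 : ℕ) : ℤ)) = (q ^ (n + 1))⁻¹ := by
      rw [← zpow_natCast, ← _root_.zpow_neg]
    have z3 : q ^ (2 * -((n + 1 : ℕ) : ℤ) + 1) = (q ^ (2 * n + 1))⁻¹ := by
      rw [← zpow_natCast, ← _root_.zpow_neg]; congr 1
    rw [z1, z2, z3]
    have hB : (1 - q) * (y * phiAux p n (y / q) z * phiAux p n y z
        + q ^ (n + 1) * (1 + z) * phiAux p n y (q * z) * phiAux p n (y / q) (z / q))
        = q * (1 - q ^ (2 * n + 1)) * (phiAux p (n - 1) y z * phiAux p (n + 1) (y / q) z) := by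
      linear_combination hD n - q * hC n
    generalize phiAux p n (y / q) z = G at *
    generalize phiAux p n y z = P at *
    generalize phiAux p n y (q * z) = Q at *
    generalize phiAux p n (y / q) (z / q) = F at *
    generalize phiAux p (n - 1) y z = P' at *
    generalize phiAux p (n + 1) (y / q) z = G' at *
    generalize (-1 : K) ^ ((n + 1) * n / 2) = s at *
    generalize (-1 : K) ^ (n * (n - 1) / 2) = t at *
    generalize (-1 : K) ^ ((n + 2) * (n + 1) / 2) = t' at *
    have hl : (q ^ (2 * n + 2))⁻¹ * y * (s * G) * (s * P)
        + (q ^ (n + 1))⁻¹ * (1 + z) * (s * Q) * (s * F)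
        = (q ^ (2 * n + 2))⁻¹ * (y * G * P + q ^ (n + 1) * (1 + z) * Q * F) := by
      have : (q ^ (n + 1))⁻¹ = (q ^ (2 * n + 2))⁻¹ * q ^ (n + 1) := by
        rw [show 2 * n + 2 = (n + 1) + (n + 1) by ring, pow_add q (n + 1) (n + 1), mul_inv,
          inv_mul_cancel_right₀ (pow_ne_zero _ hq0)]
      rw [this]
      linear_combination ((q ^ (2 * n + 2))⁻¹ * (y * G * P + q ^ (n + 1) * (1 + z) * Q * F)) * s1
    have hr : (1 - (q ^ (2 * n + 1))⁻¹) / (1 - q) * (t * P') * (t' * G')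
        = (q ^ (2 * n + 2))⁻¹ * (q * (1 - q ^ (2 * n + 1)) * (P' * G') / (1 - q)) := by
      have : (1 - (q ^ (2 * n + 1))⁻¹) = - ((q ^ (2 * n + 2))⁻¹ * (q * (1 - q ^ (2 * n + 1)))) := by
        rw [pow_succ q (2 * n + 1)]
        field_simp
        ring
      rw [this]
      linear_combination (-((q ^ (2 * n + 2))⁻¹ * (q * (1 - q ^ (2 * n + 1)))) / (1 - q)
        * P' * G') * s2
    rw [hl, hr, ← hB, mul_div_cancel_left₀ _ hq]
  · obtain ⟨n, rfl⟩ := Int.eq_ofNat_of_zero_le hN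
    have e1 : (n : ℤ) + 1 = ((n + 1 : ℕ) : ℤ) := by push_cast; ring
    have z1 : q ^ (2 * (n : ℤ)) = q ^ (2 * n) := by
      rw [← zpow_natCast]; norm_cast
    have z3 : q ^ (2 * (n : ℤ) + 1) = q ^ (2 * n + 1) := by
      rw [← zpow_natCast]; norm_cast
    rw [e1, phi_natCast_sub_one, z1, z3, zpow_natCast]
    simp only [phi_natCast]
    rw [div_mul_eq_mul_div, div_mul_eq_mul_div, eq_div_iff hq]
    linear_combination q ^ (2 * n) * hD n - hC n
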